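/- (Improved Nikolskii inequality.) Let d ≥ 1 and 0 < p < q ≤ ∞. There is a constant C (depending only on d, p, q) such that for every k ∈ ℤ and every tempered distribution f on ℝ^d which is (given by) a locally L^p function with ‖f‖_{K_p^{0,q}} < ∞ and whose distributional Fourier transform is supported in the ball {ξ : |ξ| ≤ 2^{k+1}}, one has ‖f‖_{L^q} ≤ C · 2^{kd(1/p − 1/q)} · ‖f‖_{K_p^{0,q}}. -/

import Mathlib

open MeasureTheory Real SchwartzMap ENNReal
open scoped FourierTransform ENNReal NNReal

noncomputable section

/-- Euclidean space `ℝ^d`. -/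
abbrev Ed (d : ℕ) : Type := EuclideanSpace ℝ (Fin d)

/-- The dyadic shells: `B 0 = {‖x‖ ≤ 2}` and `B l = {2^l < ‖x‖ ≤ 2^(l+1)}` for `l ≥ 1`. -/
def Bshell (d : ℕ) (l : ℕ) : Set (Ed d) :=
  if l = 0 then {x | ‖x‖ ≤ 2} else {x | (2:ℝ)^l < ‖x‖ ∧ ‖x‖ ≤ (2:ℝ)^(l+1)}

/-- Herz (quasi-)norm `K_u^{s,t}` (with the usual modification when `t = ∞`). -/
def herzNorm (d : ℕ) (u : ℝ≥0∞) (s : ℝ) (t : ℝ≥0∞) (f : Ed d → ℂ) : ℝ≥0∞ :=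
  if t = ∞ then
    ⨆ l : ℕ, ENNReal.ofReal ((2:ℝ) ^ (s * l)) * eLpNorm f u (volume.restrict (Bshell d l))
  else
    (∑' l : ℕ, (ENNReal.ofReal ((2:ℝ) ^ (s * l)) *
        eLpNorm f u (volume.restrict (Bshell d l))) ^ t.toReal) ^ (1 / t.toReal)

/-- `𝒦_u^{s,t}[m] = sup_{k ∈ ℤ} ‖(m(2^k ·) φ)^∨‖_{K_u^{s,t}}`. -/
def herzMult (d : ℕ) (m : Ed d → ℂ) (φ : Ed d → ℝ) (u : ℝ≥0∞) (s : ℝ) (t : ℝ≥0∞) : ℝ≥0∞ :=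
  ⨆ k : ℤ, herzNorm d u s t (𝓕⁻ (fun ξ : Ed d => m ((2:ℝ)^k • ξ) * (φ ξ : ℂ)))

/-- The multiplier operator `T_m f = (m ⬝ 𝓕 f)^∨` acting on a Schwartz function `f`. -/
def Tm (d : ℕ) (m : Ed d → ℂ) (f : 𝓢(Ed d, ℂ)) : Ed d → ℂ :=
  𝓕⁻ (fun ξ : Ed d => m ξ * 𝓕 (f : Ed d → ℂ) ξ)

/-- Littlewood–Paley piece `Π_k g = ϕ_k * g` with `ϕ_k = 2^{kd} ϕ(2^k ·)`. -/
def LP (d : ℕ) (ϕ : 𝓢(Ed d, ℂ)) (k : ℤ) (g : Ed d → ℂ) : Ed d → ℂ :=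
  fun x => ∫ y : Ed d, ((2:ℝ)^(k * (d:ℤ)) : ℂ) * ϕ ((2:ℝ)^k • (x - y)) * g y

/-- Hypotheses on the cutoff function `φ`: smooth, `0 ≤ φ ≤ 1`, `φ = 1` on
`{1/2 ≤ |ξ| ≤ 2}` and `supp φ ⊆ {1/4 ≤ |ξ| ≤ 4}`. -/
structure IsCutoff (d : ℕ) (φ : Ed d → ℝ) : Prop where
  smooth : ContDiff ℝ (⊤ : ℕ∞) φ
  nonneg : ∀ ξ, 0 ≤ φ ξ
  le_one : ∀ ξ, φ ξ ≤ 1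
  eq_one : ∀ ξ : Ed d, 1/2 ≤ ‖ξ‖ → ‖ξ‖ ≤ 2 → φ ξ = 1
  supp : ∀ ξ : Ed d, φ ξ ≠ 0 → 1/4 ≤ ‖ξ‖ ∧ ‖ξ‖ ≤ 4

/-- Hypotheses on the Littlewood–Paley generating function `ϕ`: `supp 𝓕ϕ ⊆ {1/2 ≤ |ξ| ≤ 2}`
and `∑_{k ∈ ℤ} 𝓕ϕ(2^{-k} ξ) = 1` for `ξ ≠ 0`. -/
structure IsLPfun (d : ℕ) (ϕ : 𝓢(Ed d, ℂ)) : Prop where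
  supp : ∀ ξ : Ed d, 𝓕 (ϕ : Ed d → ℂ) ξ ≠ 0 → 1/2 ≤ ‖ξ‖ ∧ ‖ξ‖ ≤ 2
  sum_one : ∀ ξ : Ed d, ξ ≠ 0 → ∑' k : ℤ, 𝓕 (ϕ : Ed d → ℂ) ((2:ℝ)^(-k) • ξ) = 1

/-- Homogeneous Besov quasi-norm `‖g‖_{Ḃ_p^{0,q}}`. -/
def besovNorm (d : ℕ) (p q : ℝ≥0∞) (ϕ : 𝓢(Ed d, ℂ)) (g : Ed d → ℂ) : ℝ≥0∞ :=
  if q = ∞ then ⨆ k : ℤ, eLpNorm (LP d ϕ k g) p volume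
  else (∑' k : ℤ, (eLpNorm (LP d ϕ k g) p volume) ^ q.toReal) ^ (1 / q.toReal)

/-- The dyadic cube with side length `2^{-n}` and lower-left corner `2^{-n} z`. -/
def dyadicCube (d : ℕ) (n : ℤ) (z : Fin d → ℤ) : Set (Ed d) :=
  {x | ∀ i, (z i : ℝ) * (2:ℝ)^(-n) ≤ x i ∧ x i < ((z i : ℝ) + 1) * (2:ℝ)^(-n)}

/-- Inner `ℓ^q` functional `(∑_{k ∈ ℤ} |Π_k g(x)|^q)^{1/q}` (sup if `q = ∞`). -/
def lqFun (d : ℕ) (q : ℝ≥0∞) (ϕ : 𝓢(Ed d, ℂ)) (g : Ed d → ℂ) (x : Ed d) : ℝ≥0∞ :=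
  if q = ∞ then ⨆ k : ℤ, (‖LP d ϕ k g x‖₊ : ℝ≥0∞)
  else (∑' k : ℤ, (‖LP d ϕ k g x‖₊ : ℝ≥0∞) ^ q.toReal) ^ (1 / q.toReal)

/-- Homogeneous Triebel–Lizorkin quasi-norm `‖g‖_{Ḟ_p^{0,q}}`, including the
`p = ∞` cases. -/
def tlNorm (d : ℕ) (p q : ℝ≥0∞) (ϕ : 𝓢(Ed d, ℂ)) (g : Ed d → ℂ) : ℝ≥0∞ :=
  if p = ∞ then
    if q = ∞ then ⨆ k : ℤ, eLpNorm (LP d ϕ k g) ∞ volume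
    else ⨆ (n : ℤ) (z : Fin d → ℤ),
      ((volume (dyadicCube d n z))⁻¹ *
        ∫⁻ x in dyadicCube d n z,
          ∑' k : {j : ℤ // n ≤ j}, (‖LP d ϕ (k : ℤ) g x‖₊ : ℝ≥0∞) ^ q.toReal) ^ (1 / q.toReal)
  else
    (∫⁻ x, (lqFun d q ϕ g x) ^ p.toReal) ^ (1 / p.toReal)

/-- Weighted Herz norm `K_u^{0,t}(w)` with weight `w : ℕ → [1,∞)`. -/
def herzNormW (d : ℕ) (w : ℕ → ℝ) (u t : ℝ≥0∞) (f : Ed d → ℂ) : ℝ≥0∞ :=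
  if t = ∞ then
    ⨆ l : ℕ, ENNReal.ofReal (w l) * eLpNorm f u (volume.restrict (Bshell d l))
  else
    (∑' l : ℕ, (ENNReal.ofReal (w l) *
      eLpNorm f u (volume.restrict (Bshell d l))) ^ t.toReal) ^ (1 / t.toReal)

/-- `𝒦_u^{0,t}(w)[m] = sup_{k ∈ ℤ} ‖(m(2^k ·) φ)^∨‖_{K_u^{0,t}(w)}`. -/
def herzMultW (d : ℕ) (m : Ed d → ℂ) (φ : Ed d → ℝ) (w : ℕ → ℝ) (u t : ℝ≥0∞) : ℝ≥0∞ :=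
  ⨆ k : ℤ, herzNormW d w u t (𝓕⁻ (fun ξ : Ed d => m ((2:ℝ)^k • ξ) * (φ ξ : ℂ)))

/-- `M_r g = (M(|g|^r))^{1/r}` where `M` is the Hardy–Littlewood maximal operator
(supremum of averages over balls containing the point). -/
def maxFn (d : ℕ) (r : ℝ) (g : Ed d → ℂ) (x : Ed d) : ℝ≥0∞ :=
  (⨆ (c : Ed d) (ρ : ℝ) (_ : 0 < ρ) (_ : x ∈ Metric.ball c ρ),
    (volume (Metric.ball c ρ))⁻¹ * ∫⁻ y in Metric.ball c ρ, (‖g y‖₊ : ℝ≥0∞) ^ r) ^ (1 / r)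

/-- The Peetre maximal function `𝔐_{σ,2^k} g (y) = sup_w |g(y-w)| / (1+2^k|w|)^σ`. -/
def peetreMax (d : ℕ) (σ : ℝ) (k : ℤ) (g : Ed d → ℂ) (y : Ed d) : ℝ≥0∞ :=
  ⨆ w : Ed d, (‖g (y - w)‖₊ : ℝ≥0∞) / ENNReal.ofReal ((1 + (2:ℝ)^k * ‖w‖) ^ σ)

section Fourier
variable {E : Type*} [NormedAddCommGroup E] [InnerProductSpace ℝ E] [FiniteDimensional ℝ E]
  [MeasurableSpace E] [BorelSpace E]

/-- The Fourier transform of `θ · 𝓕⁻ g` is the correlation of `𝓕⁻ θ` and `g`. -/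
theorem fourier_mul_fourierInv_eq_integral (θ g : 𝓢(E, ℂ)) (x : E) :
    𝓕 (fun ξ : E => θ ξ * 𝓕⁻ (g : E → ℂ) ξ) x =
      ∫ y : E, 𝓕⁻ (θ : E → ℂ) (y - x) * g y := by
  set a : E → ℂ := fun ξ => 𝐞 (-inner ℝ ξ x) • θ ξ with ha
  have haint : Integrable a := by
    have := (VectorFourier.fourierIntegral_convergent_iff (μ := volume) (L := innerₗ E)
      continuous_fourierChar (by exact continuous_inner) (f := (θ : E → ℂ)) x).2 θ.integrable
    simpa [ha] using this
  have hflip := VectorFourier.integral_fourierIntegral_smul_eq_flip (μ := volume) (ν := volume)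
    (L := -innerₗ E) (e := 𝐞) continuous_fourierChar
    (by exact continuous_inner.neg) haint g.integrable
  have h1 : ∀ y, VectorFourier.fourierIntegral 𝐞 volume (-innerₗ E) a y =
      𝓕⁻ (θ : E → ℂ) (y - x) := by
    intro y
    rw [Real.fourierInv_eq, VectorFourier.fourierIntegral]
    congr 1
    ext ξ
    simp only [ha, smul_smul, ← AddChar.map_add_eq_mul]
    congr 2
    simp only [LinearMap.neg_apply, innerₗ_apply_apply, neg_neg, inner_sub_right]
    ring
  have h2 : ∀ ξ, VectorFourier.fourierIntegral 𝐞 volume (-innerₗ E).flip g ξ =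
      𝓕⁻ (g : E → ℂ) ξ := by
    intro ξ
    rw [Real.fourierInv_eq, VectorFourier.fourierIntegral]
    congr 1
    ext v
    simp [real_inner_comm]
  simp only [h1, h2, smul_eq_mul] at hflip
  rw [hflip, Real.fourier_eq]
  congr 1
  ext ξ
  simp [ha, smul_mul_assoc]

/-- A Schwartz function decays faster than any power of `1 + ‖x‖`. -/
theorem SchwartzMap.exists_pow_mul_norm_le {E : Type*} [NormedAddCommGroup E]
    [NormedSpace ℝ E] (φ : 𝓢(E, ℂ)) (n : ℕ) :
    ∃ C : ℝ, ∀ x, (1 + ‖x‖) ^ n * ‖φ x‖ ≤ C := by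
  refine ⟨2 ^ n * (Finset.Iic (n, 0)).sup (fun m => SchwartzMap.seminorm ℝ m.1 m.2) φ,
    fun x => ?_⟩
  simpa using SchwartzMap.one_add_le_sup_seminorm_apply (𝕜 := ℝ) (m := (n, 0)) (k := n) (n := 0)
    le_rfl le_rfl φ x

theorem SchwartzMap.integrable_pow_mul_norm (φ : 𝓢(E, ℂ)) (n : ℕ) :
    Integrable fun x => (1 + ‖x‖) ^ n * ‖φ x‖ := by
  have h : ∀ j : ℕ, Integrable fun x : E => ‖x‖ ^ j * ‖φ x‖ := fun j =>
    φ.integrable_pow_mul volume j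
  simp_rw [add_comm (1 : ℝ), add_pow, Finset.sum_mul]
  refine integrable_finsetSum _ fun j _ => ?_
  refine ((h j).mul_const ((n.choose j : ℝ))).congr (.of_forall fun x => ?_)
  simp only [one_pow]
  ring

theorem one_add_norm_le_mul {E : Type*} [SeminormedAddCommGroup E] (x y : E) :
    1 + ‖x‖ ≤ (1 + ‖y‖) * (1 + ‖y - x‖) := by
  have : ‖x‖ ≤ ‖y‖ + ‖y - x‖ := by
    have := norm_sub_le y (y - x)
    simpa using this
  nlinarith [norm_nonneg y, norm_nonneg (y - x), mul_nonneg (norm_nonneg y) (norm_nonneg (y - x))]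

/-- A function of polynomial growth whose distributional Fourier transform is supported in
`‖ξ‖ ≤ ρ` is reproduced by convolution with `𝓕⁻ θ` whenever `θ = 1` on that ball. -/
theorem eq_integral_mul_fourierInv_of_fourier_support {f : E → ℂ} (hf : Continuous f)
    {K : ℝ} {m : ℕ} (hK : ∀ x, ‖f x‖ ≤ K * (1 + ‖x‖) ^ m) {ρ : ℝ}
    (hsupp : ∀ ψ : 𝓢(E, ℂ), (∀ ξ : E, ‖ξ‖ ≤ ρ → ψ ξ = 0) →
      ∫ x : E, f x * 𝓕 (ψ : E → ℂ) x = 0)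
    (θ : 𝓢(E, ℂ)) (hθ : ∀ ξ, ‖ξ‖ ≤ ρ → θ ξ = 1) (x : E) :
    f x = ∫ y, f y * 𝓕⁻ (θ : E → ℂ) (x - y) := by
  have hK0 : 0 ≤ K := by
    have := (norm_nonneg _).trans (hK 0)
    simpa using this
  set Φ : 𝓢(E, ℂ) := 𝓕⁻ θ with hΦ
  have hΦc : 𝓕⁻ (θ : E → ℂ) = Φ := (fourierInv_coe θ).symm
  rw [hΦc]
  have hbound : ∀ x z : E, ‖f (x - z)‖ ≤ K * (1 + ‖x‖) ^ m * (1 + ‖z‖) ^ m := by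
    intro x z
    refine (hK _).trans ?_
    rw [mul_assoc, ← mul_pow]
    gcongr
    simpa using one_add_norm_le_mul (x - z) x
  set F : E → ℂ := fun x => ∫ y, f y * Φ (x - y) with hF
  have hFz : ∀ x, F x = ∫ z, f (x - z) * Φ z := by
    intro x
    rw [hF, ← integral_sub_left_eq_self _ volume x]
    simp
  have hFc : Continuous F := by
    simp_rw [show F = fun x => ∫ z, f (x - z) * Φ z from funext hFz]
    refine continuous_iff_continuousAt.2 fun x₀ => ?_
    refine continuousAt_of_dominated (bound := fun z => K * (1 + (‖x₀‖ + 1)) ^ m *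
      ((1 + ‖z‖) ^ m * ‖Φ z‖)) (.of_forall fun x => ?_) ?_ ?_ (.of_forall fun z => ?_)
    · exact (by fun_prop : Continuous fun z => f (x - z) * Φ z).aestronglyMeasurable
    · filter_upwards [Metric.ball_mem_nhds x₀ one_pos] with x hx
      refine .of_forall fun z => ?_
      rw [norm_mul, ← mul_assoc]
      gcongr
      refine (hbound x z).trans ?_
      gcongr
      have := norm_sub_norm_le x x₀
      rw [mem_ball_iff_norm] at hx
      linarith
    · exact (Φ.integrable_pow_mul_norm m).const_mul _
    · fun_prop
  suffices f =ᵐ[volume] F from congrFun (hf.ae_eq_iff_eq volume hFc |>.1 this) x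
  refine ae_eq_of_integral_contDiff_smul_eq hf.locallyIntegrable hFc.locallyIntegrable ?_
  intro g hg hgc
  set gs : 𝓢(E, ℂ) := (hgc.comp_left (g := ((↑) : ℝ → ℂ)) (by simp)).toSchwartzMap
    (Complex.ofRealCLM.contDiff.comp hg) with hgs
  have hgsx : ∀ x, gs x = (g x : ℂ) := fun x => rfl
  set G : 𝓢(E, ℂ) := 𝓕⁻ gs with hG
  set P : 𝓢(E, ℂ) := smulLeftCLM ℂ (θ : E → ℂ) G with hP
  have hPx : ∀ ξ, P ξ = θ ξ * G ξ := fun ξ => by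
    rw [hP, smulLeftCLM_apply_apply θ.hasTemperateGrowth, smul_eq_mul]
  have h0 := hsupp (G - P) (fun ξ hξ => by simp [hPx, hθ ξ hξ])
  have hFP : ∀ x, 𝓕 ((G - P : 𝓢(E, ℂ)) : E → ℂ) x = g x - ∫ y, Φ (y - x) * g y := by
    intro x
    have e1 : 𝓕 ((G - P : 𝓢(E, ℂ)) : E → ℂ) = (𝓕 G - 𝓕 P : 𝓢(E, ℂ)) := by
      rw [← fourier_coe]
      exact congrArg _ ((FourierTransform.fourierCLM ℂ 𝓢(E, ℂ)).map_sub G P)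
    have e2 : (𝓕 P : 𝓢(E, ℂ)) x = ∫ y, Φ (y - x) * gs y := by
      rw [← hΦc, ← fourier_mul_fourierInv_eq_integral θ gs x, fourier_coe,
        ← fourierInv_coe]
      exact congrArg (fun h : E → ℂ => 𝓕 h x) (funext hPx)
    rw [e1, sub_apply, e2, hG, FourierTransform.fourier_fourierInv_eq]
    rfl
  -- the double integral converges absolutely
  have hdom : Integrable (fun p : E × E => f p.1 * (Φ (p.2 - p.1) * g p.2))
      (volume.prod volume) := by
    have ha : Integrable fun y => K * (1 + ‖y‖) ^ m * ‖gs y‖ := by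
      simpa [mul_assoc] using (gs.integrable_pow_mul_norm m).const_mul K
    have hb := (Φ.integrable_pow_mul_norm m).comp_neg
    refine (ha.convolution_integrand (ContinuousLinearMap.mul ℝ ℝ) hb).mono ?_
      (.of_forall fun p => ?_)
    · have := hg.continuous
      exact (by fun_prop : Continuous fun p : E × E =>
        f p.1 * (Φ (p.2 - p.1) * g p.2)).aestronglyMeasurable
    · simp only [ContinuousLinearMap.mul_apply', norm_mul, neg_sub, hgsx, norm_norm,
        Complex.norm_real, norm_pow]
      have h1 := hbound p.2 (p.2 - p.1)
      rw [_root_.sub_sub_cancel] at h1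
      have e3 : ‖1 + ‖p.2‖‖ = 1 + ‖p.2‖ := Real.norm_of_nonneg (by positivity)
      have e4 : ‖1 + ‖p.2 - p.1‖‖ = 1 + ‖p.2 - p.1‖ := Real.norm_of_nonneg (by positivity)
      rw [e3, e4, Real.norm_of_nonneg hK0]
      calc _ ≤ (K * (1 + ‖p.2‖) ^ m * (1 + ‖p.2 - p.1‖) ^ m) * (‖Φ (p.2 - p.1)‖ * ‖g p.2‖) := by
            gcongr
        _ = _ := by ring
  have hfg : Integrable fun x => f x * g x :=
    (hf.mul (Complex.continuous_ofReal.comp hg.continuous)).integrable_of_hasCompactSupport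
      ((hgc.comp_left (g := ((↑) : ℝ → ℂ)) (by simp)).mul_left)
  simp_rw [hFP, mul_sub, ← integral_const_mul] at h0
  rw [integral_sub hfg hdom.integral_prod_left, integral_integral_swap hdom] at h0
  have e5 : ∀ y, ∫ x, f x * (Φ (y - x) * g y) = g y • F y := by
    intro y
    rw [hF, ← integral_smul]
    congr 1
    ext x
    simp only [Complex.real_smul]
    ring
  simp_rw [e5] at h0
  rw [← sub_eq_zero.1 h0]
  congr 1
  ext x
  simp [mul_comm]

/-- Rescaled form of `eq_integral_mul_fourierInv_of_fourier_support`: after dilating a function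
band-limited to `‖ξ‖ ≤ c * ρ` by `c⁻¹`, one kernel independent of `c` reproduces it. -/
theorem comp_smul_eq_integral_of_fourier_support {f : E → ℂ} (hf : Continuous f)
    {K : ℝ} {m : ℕ} (hK : ∀ x, ‖f x‖ ≤ K * (1 + ‖x‖) ^ m) {c ρ : ℝ} (hc : 0 < c)
    (hsupp : ∀ ψ : 𝓢(E, ℂ), (∀ ξ : E, ‖ξ‖ ≤ c * ρ → ψ ξ = 0) →
      ∫ x : E, f x * 𝓕 (ψ : E → ℂ) x = 0)
    (θ : 𝓢(E, ℂ)) (hθ : ∀ ξ, ‖ξ‖ ≤ ρ → θ ξ = 1) (x : E) :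
    f (c⁻¹ • x) = ∫ y, f (c⁻¹ • y) * 𝓕⁻ (θ : E → ℂ) (x - y) := by
  set θc : 𝓢(E, ℂ) := SchwartzMap.compCLMOfContinuousLinearEquiv ℂ
    (ContinuousLinearEquiv.smulLeft (Units.mk0 c⁻¹ (inv_ne_zero hc.ne'))) θ with hθc
  have hθcx : ∀ ξ, θc ξ = θ (c⁻¹ • ξ) := fun ξ => rfl
  rw [eq_integral_mul_fourierInv_of_fourier_support hf hK hsupp θc ?_ (c⁻¹ • x)]
  · have h1 : ∀ z, 𝓕⁻ (θc : E → ℂ) z = (c ^ Module.finrank ℝ E : ℝ) • 𝓕⁻ (θ : E → ℂ) (c • z) := by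
      intro z
      have := Measure.integral_comp_inv_smul_of_nonneg volume
        (fun ξ : E => 𝐞 (inner ℝ ξ (c • z)) • θ ξ) hc.le
      rw [Real.fourierInv_eq, Real.fourierInv_eq, ← this]
      congr 1
      ext ξ
      rw [hθcx, inner_smul_left, inner_smul_right]
      simp [hc.ne']
    have h2 := Measure.integral_comp_smul_of_nonneg volume
      (fun y : E => f (c⁻¹ • y) * 𝓕⁻ (θ : E → ℂ) (x - y)) c (hR := hc.le)
    rw [eq_inv_smul_iff₀ (by positivity)] at h2
    rw [← h2, ← integral_smul]
    congr 1
    ext y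
    simp only [h1, smul_sub, smul_inv_smul₀ hc.ne', inv_smul_smul₀ hc.ne', mul_smul_comm]
  · intro ξ hξ
    rw [hθcx]
    apply hθ
    rw [norm_smul, norm_inv, Real.norm_of_nonneg hc.le, inv_mul_le_iff₀ hc]
    exact hξ

theorem exists_schwartzMap_eq_one_on_ball {E : Type*} [NormedAddCommGroup E]
    [InnerProductSpace ℝ E] [FiniteDimensional ℝ E] (ρ : ℝ) (hρ : 0 < ρ) :
    ∃ θ : 𝓢(E, ℂ), ∀ ξ, ‖ξ‖ ≤ ρ → θ ξ = 1 := by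
  let b : ContDiffBump (0 : E) := ⟨ρ, ρ + 1, hρ, by linarith⟩
  refine ⟨(b.hasCompactSupport.comp_left (g := ((↑) : ℝ → ℂ)) (by simp)).toSchwartzMap
    (Complex.ofRealCLM.contDiff.comp b.contDiff), fun ξ hξ => ?_⟩
  have := b.one_of_mem_closedBall (x := ξ) (by simpa [b] using hξ)
  change ((b ξ : ℝ) : ℂ) = 1
  rw [this, Complex.ofReal_one]

end Fourier

section Peetre

/-- The weight `1 + ‖x‖`, as an extended nonnegative real. -/
def eBracket {E : Type*} [NormedAddCommGroup E] (x : E) : ℝ≥0∞ := 1 + ‖x‖ₑ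

variable {E : Type*} [NormedAddCommGroup E]

theorem one_le_eBracket (x : E) : 1 ≤ eBracket x := le_self_add

theorem eBracket_ne_zero (x : E) : eBracket x ≠ 0 :=
  (zero_lt_one.trans_le (one_le_eBracket x)).ne'

theorem eBracket_ne_top (x : E) : eBracket x ≠ ∞ := by simp [eBracket]

@[simp] theorem eBracket_zero : eBracket (0 : E) = 1 := by simp [eBracket]

@[simp] theorem eBracket_neg (x : E) : eBracket (-x) = eBracket x := by simp [eBracket]

theorem eBracket_add_le (x y : E) : eBracket (x + y) ≤ eBracket x * eBracket y := by
  simp only [eBracket]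
  calc 1 + ‖x + y‖ₑ ≤ 1 + (‖x‖ₑ + ‖y‖ₑ) := by gcongr; exact enorm_add_le x y
    _ ≤ 1 + (‖x‖ₑ + ‖y‖ₑ) + ‖x‖ₑ * ‖y‖ₑ := le_self_add
    _ = (1 + ‖x‖ₑ) * (1 + ‖y‖ₑ) := by ring

theorem eBracket_rpow_ne_top (x : E) (s : ℝ) : eBracket x ^ s ≠ ∞ :=
  ENNReal.rpow_ne_top_of_ne_zero (eBracket_ne_zero x) (eBracket_ne_top x)

theorem eBracket_rpow_ne_zero (x : E) (s : ℝ) : eBracket x ^ s ≠ 0 := by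
  simp [ENNReal.rpow_eq_zero_iff, eBracket_ne_zero, eBracket_ne_top]

theorem eBracket_rpow_neg_mul_le (x y : E) {s : ℝ} (hs : 0 ≤ s) :
    eBracket x ^ (-s) * eBracket y ^ (-s) ≤ eBracket (x + y) ^ (-s) := by
  rw [← ENNReal.mul_rpow_of_ne_top (eBracket_ne_top x) (eBracket_ne_top y), ENNReal.rpow_neg,
    ENNReal.rpow_neg, ENNReal.inv_le_inv]
  gcongr
  exact eBracket_add_le x y

theorem eBracket_rpow_neg_le_one (x : E) {s : ℝ} (hs : 0 ≤ s) : eBracket x ^ (-s) ≤ 1 := by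
  rw [ENNReal.rpow_neg, ENNReal.inv_le_one]
  simpa using ENNReal.rpow_le_rpow (one_le_eBracket x) hs

variable [MeasurableSpace E] {μ : Measure E}

/-- Self-improvement of a reproducing inequality for the Peetre maximal function, under the
a priori assumption that the latter is finite. -/
theorem iSup_rpow_le_lintegral {u κ : E → ℝ≥0∞} {C : ℝ≥0∞} {r s : ℝ}
    (hr : 0 < r) (hr1 : r ≤ 1) (hs : 0 ≤ s)
    (hu : ∀ x, u x ≤ ∫⁻ y, u y * κ (x - y) ∂μ) (hC : C ≠ ∞)
    (hκ : ∀ z, κ z ≤ C * eBracket z ^ (-s)) {x : E}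
    (hG : ⨆ v, u v * eBracket (x - v) ^ (-s) ≠ ∞) :
    (⨆ v, u v * eBracket (x - v) ^ (-s)) ^ r ≤
      C * ∫⁻ y, u y ^ r * eBracket (x - y) ^ (-(s * r)) ∂μ := by
  set G := ⨆ v, u v * eBracket (x - v) ^ (-s) with hGdef
  set I := ∫⁻ y, u y ^ r * eBracket (x - y) ^ (-(s * r)) ∂μ with hI
  have huG : ∀ y, u y ≤ G * eBracket (x - y) ^ s := by
    intro y
    have h := le_iSup (fun v => u v * eBracket (x - v) ^ (-s)) y
    rw [← hGdef] at h
    rwa [ENNReal.rpow_neg, ← div_eq_mul_inv, ENNReal.div_le_iff (eBracket_rpow_ne_zero _ _)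
      (eBracket_rpow_ne_top _ _)] at h
  have hr0 : 0 ≤ 1 - r := sub_nonneg.2 hr1
  have hG1 : G ^ (1 - r) ≠ ∞ := ENNReal.rpow_ne_top_of_nonneg hr0 hG
  have key : G ≤ C * G ^ (1 - r) * I := by
    refine iSup_le fun v => ?_
    rw [hI, ← lintegral_const_mul' _ _ (ENNReal.mul_ne_top hC hG1)]
    calc u v * eBracket (x - v) ^ (-s)
        ≤ (∫⁻ y, u y * κ (v - y) ∂μ) * eBracket (x - v) ^ (-s) := by gcongr; exact hu v
      _ = ∫⁻ y, u y * κ (v - y) * eBracket (x - v) ^ (-s) ∂μ :=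
          (lintegral_mul_const' _ _ (eBracket_rpow_ne_top _ _)).symm
      _ ≤ _ := lintegral_mono fun y => ?_
    have h1 : u y = u y ^ r * u y ^ (1 - r) := by
      rw [← ENNReal.rpow_add_of_nonneg _ _ hr.le hr0]; simp
    have h2 : u y ^ (1 - r) ≤ G ^ (1 - r) * eBracket (x - y) ^ (s * (1 - r)) := by
      refine (ENNReal.rpow_le_rpow (huG y) hr0).trans_eq ?_
      rw [ENNReal.mul_rpow_of_nonneg _ _ hr0, ← ENNReal.rpow_mul]
    have h3 : eBracket (v - y) ^ (-s) * eBracket (x - v) ^ (-s) ≤ eBracket (x - y) ^ (-s) := by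
      have := eBracket_rpow_neg_mul_le (v - y) (x - v) hs
      rwa [sub_add_sub_cancel'] at this
    have h4 : eBracket (x - y) ^ (s * (1 - r)) * eBracket (x - y) ^ (-s) =
        eBracket (x - y) ^ (-(s * r)) := by
      rw [← ENNReal.rpow_add _ _ (eBracket_ne_zero _) (eBracket_ne_top _)]
      congr 1; ring
    calc u y * κ (v - y) * eBracket (x - v) ^ (-s)
        ≤ (u y ^ r * (G ^ (1 - r) * eBracket (x - y) ^ (s * (1 - r)))) *
            (C * eBracket (v - y) ^ (-s)) * eBracket (x - v) ^ (-s) := by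
          gcongr
          · exact h1.le.trans (by gcongr)
          · exact hκ _
      _ = C * G ^ (1 - r) * u y ^ r * eBracket (x - y) ^ (s * (1 - r)) *
            (eBracket (v - y) ^ (-s) * eBracket (x - v) ^ (-s)) := by ring
      _ ≤ C * G ^ (1 - r) * u y ^ r * eBracket (x - y) ^ (s * (1 - r)) *
            eBracket (x - y) ^ (-s) := by gcongr
      _ = C * G ^ (1 - r) * (u y ^ r * eBracket (x - y) ^ (-(s * r))) := by
          rw [← h4]; ring
  rcases eq_or_ne G 0 with h0 | h0
  · simp [h0, hr]
  have h5 : G = G ^ r * G ^ (1 - r) := by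
    rw [← ENNReal.rpow_add_of_nonneg _ _ hr.le hr0]; simp
  have h6 : G ^ (1 - r) ≠ 0 := by simp [ENNReal.rpow_eq_zero_iff, h0, hG]
  rw [← ENNReal.mul_le_mul_iff_left h6 hG1, ← h5]
  exact key.trans_eq (by ring)

/-- Self-improvement of a reproducing inequality for functions of polynomial growth, with a
constant independent of the order of growth. -/
theorem rpow_le_mul_lintegral_of_polynomial_growth {u κ : E → ℝ≥0∞} {C : ℝ≥0∞} {r s : ℝ}
    (hr : 0 < r) (hr1 : r ≤ 1) (hs : 0 ≤ s)
    (hu : ∀ x, u x ≤ ∫⁻ y, u y * κ (x - y) ∂μ) (hC0 : C ≠ 0) (hC : C ≠ ∞)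
    (hκ : ∀ z, κ z ≤ C * eBracket z ^ (-s))
    (hκ' : ∀ t : ℝ, ∃ D : ℝ≥0∞, D ≠ ∞ ∧ ∀ z, κ z ≤ D * eBracket z ^ (-t))
    {K : ℝ≥0∞} {m : ℝ} (hm : 0 ≤ m) (hK : K ≠ ∞) (hgrowth : ∀ x, u x ≤ K * eBracket x ^ m)
    (x v : E) :
    u v ^ r ≤ C * eBracket (x - v) ^ (s * r) *
      ∫⁻ y, u y ^ r * eBracket (x - y) ^ (-(s * r)) ∂μ := by
  set I := ∫⁻ y, u y ^ r * eBracket (x - y) ^ (-(s * r)) ∂μ with hI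
  rcases eq_or_ne I ∞ with hItop | hItop
  · rw [hItop, ENNReal.mul_top (mul_ne_zero hC0 (eBracket_rpow_ne_zero _ _))]
    exact le_top
  obtain ⟨D, hD, hDκ⟩ := hκ' (s + m)
  have hsm : 0 ≤ s + m := add_nonneg hs hm
  have hfin : ∀ x, ⨆ v, u v * eBracket (x - v) ^ (-(s + m)) ≠ ∞ := by
    intro x
    refine ne_top_of_le_ne_top (ENNReal.mul_ne_top hK (eBracket_rpow_ne_top x m))
      (iSup_le fun v => ?_)
    have h1 : eBracket v ^ m ≤ eBracket x ^ m * eBracket (x - v) ^ m := by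
      rw [← ENNReal.mul_rpow_of_nonneg _ _ hm]
      gcongr
      simpa [← eBracket_neg (x - v)] using eBracket_add_le x (v - x)
    calc u v * eBracket (x - v) ^ (-(s + m))
        ≤ K * (eBracket x ^ m * eBracket (x - v) ^ m) *
          (eBracket (x - v) ^ (-s) * eBracket (x - v) ^ (-m)) := by
          rw [neg_add, ENNReal.rpow_add _ _ (eBracket_ne_zero _) (eBracket_ne_top _)]
          gcongr
          exact (hgrowth v).trans (by gcongr)
      _ = K * eBracket x ^ m * eBracket (x - v) ^ (-s) *
          (eBracket (x - v) ^ m * eBracket (x - v) ^ (-m)) := by ring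
      _ ≤ K * eBracket x ^ m * 1 * 1 := by
          gcongr
          · exact eBracket_rpow_neg_le_one _ hs
          · rw [← ENNReal.rpow_add _ _ (eBracket_ne_zero _) (eBracket_ne_top _)]; simp
      _ = _ := by simp
  have hpt : ∀ v, u v ^ r ≤ D * ∫⁻ y, u y ^ r * eBracket (v - y) ^ (-((s + m) * r)) ∂μ := by
    intro v
    refine le_trans ?_ (iSup_rpow_le_lintegral hr hr1 hsm hu hD hDκ (hfin v))
    gcongr
    simpa using le_iSup (fun w => u w * eBracket (v - w) ^ (-(s + m))) v
  have hG : ⨆ v, u v * eBracket (x - v) ^ (-s) ≠ ∞ := by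
    suffices h : (⨆ v, u v * eBracket (x - v) ^ (-s)) ^ r ≤ D * I by
      intro htop
      rw [htop, ENNReal.top_rpow_of_pos hr, top_le_iff] at h
      exact ENNReal.mul_ne_top hD hItop h
    rw [ENNReal.le_rpow_inv_iff hr |>.symm]
    refine iSup_le fun v => ?_
    rw [ENNReal.le_rpow_inv_iff hr, ENNReal.mul_rpow_of_nonneg _ _ hr.le, ← ENNReal.rpow_mul]
    calc u v ^ r * eBracket (x - v) ^ (-s * r)
        ≤ (D * ∫⁻ y, u y ^ r * eBracket (v - y) ^ (-((s + m) * r)) ∂μ) *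
            eBracket (x - v) ^ (-s * r) := by gcongr; exact hpt v
      _ = D * ∫⁻ y, u y ^ r * eBracket (v - y) ^ (-((s + m) * r)) *
            eBracket (x - v) ^ (-s * r) ∂μ := by
          rw [lintegral_mul_const' _ _ (eBracket_rpow_ne_top _ _), mul_assoc]
      _ ≤ D * I := by
          gcongr
          refine lintegral_mono fun y => ?_
          rw [mul_assoc]
          gcongr
          calc eBracket (v - y) ^ (-((s + m) * r)) * eBracket (x - v) ^ (-s * r)
              ≤ eBracket (v - y) ^ (-(s * r)) * eBracket (x - v) ^ (-(s * r)) := by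
                rw [neg_mul]
                gcongr
                · exact one_le_eBracket _
                · linarith
            _ ≤ eBracket (x - y) ^ (-(s * r)) := by
                have := eBracket_rpow_neg_mul_le (v - y) (x - v) (mul_nonneg hs hr.le)
                rwa [sub_add_sub_cancel'] at this
  have hfinal := iSup_rpow_le_lintegral hr hr1 hs hu hC hκ hG
  have h7 := (ENNReal.rpow_le_rpow (le_iSup (fun v => u v * eBracket (x - v) ^ (-s)) v)
    hr.le).trans hfinal
  rw [ENNReal.mul_rpow_of_nonneg _ _ hr.le, ← ENNReal.rpow_mul, neg_mul, ENNReal.rpow_neg,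
    ← div_eq_mul_inv, ENNReal.div_le_iff (eBracket_rpow_ne_zero _ _)
      (eBracket_rpow_ne_top _ _)] at h7
  exact h7.trans_eq (by ring)

end Peetre

section Jensen
variable {α : Type*} [MeasurableSpace α] {μ : Measure α}

/-- Jensen's inequality for the power function and a weight `w`. -/
theorem lintegral_mul_rpow_le {g w : α → ℝ≥0∞} (hg : AEMeasurable g μ) (hw : AEMeasurable w μ)
    {t : ℝ} (ht : 1 ≤ t) :
    (∫⁻ x, g x * w x ∂μ) ^ t ≤ (∫⁻ x, w x ∂μ) ^ (t - 1) * ∫⁻ x, g x ^ t * w x ∂μ := by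
  have ht0 : 0 < t := one_pos.trans_le ht
  have h1 : 0 ≤ 1 - t⁻¹ := sub_nonneg.2 (inv_le_one_of_one_le₀ ht)
  have h := ENNReal.lintegral_mul_norm_pow_le (μ := μ) ((hg.pow_const t).mul hw) hw
    (inv_nonneg.2 ht0.le) h1 (by ring)
  have e : ∀ x, (g x ^ t * w x) ^ t⁻¹ * w x ^ (1 - t⁻¹) = g x * w x := fun x => by
    rw [ENNReal.mul_rpow_of_nonneg _ _ (inv_nonneg.2 ht0.le), ENNReal.rpow_rpow_inv ht0.ne',
      mul_assoc, ← ENNReal.rpow_add_of_nonneg _ _ (inv_nonneg.2 ht0.le) h1]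
    simp
  simp only [Pi.mul_apply, e] at h
  refine (ENNReal.rpow_le_rpow h ht0.le).trans_eq ?_
  rw [ENNReal.mul_rpow_of_nonneg _ _ ht0.le, ENNReal.rpow_inv_rpow ht0.ne', ← ENNReal.rpow_mul,
    mul_comm, sub_mul, inv_mul_cancel₀ ht0.ne', one_mul]

/-- Jensen's inequality for the power function and a weight `w`, for series. -/
theorem ENNReal.tsum_mul_rpow_le {ι : Type*} (g w : ι → ℝ≥0∞) {t : ℝ} (ht : 1 ≤ t) :
    (∑' i, g i * w i) ^ t ≤ (∑' i, w i) ^ (t - 1) * ∑' i, g i ^ t * w i := by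
  let _ : MeasurableSpace ι := ⊤
  have : MeasurableSingletonClass ι := ⟨fun _ => trivial⟩
  have h := lintegral_mul_rpow_le (μ := Measure.count) (g := g) (w := w)
    measurable_from_top.aemeasurable measurable_from_top.aemeasurable ht
  simpa only [lintegral_count] using h

end Jensen

section Peetre
variable {E : Type*} [NormedAddCommGroup E] [MeasurableSpace E] [BorelSpace E] {μ : Measure E}

@[fun_prop]
theorem measurable_eBracket : Measurable (eBracket : E → ℝ≥0∞) := by
  unfold eBracket; fun_prop

/-- A function controlled by its own weighted averages is already controlled by weighted
averages avoiding a small ball around the origin. -/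
theorem le_mul_setLIntegral_compl_closedBall {g : E → ℝ≥0∞} {C M : ℝ≥0∞} {σ δ : ℝ} (hσ : 0 ≤ σ)
    (hg : ∀ x v, g v ≤ C * eBracket (x - v) ^ σ * ∫⁻ y, g y * eBracket (x - y) ^ (-σ) ∂μ)
    (hδ1 : δ ≤ 1) (hδ : C * μ (Metric.closedBall 0 δ) ≤ 2⁻¹)
    (hμ : μ (Metric.closedBall 0 δ) ≠ ∞)
    (hM : M ≠ ∞) (hgM : ∀ y ∈ Metric.closedBall 0 δ, g y ≤ M) (x : E) :
    g x ≤ C * (1 + 2 ^ σ * 2 ^ σ) *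
      ∫⁻ y in (Metric.closedBall 0 δ)ᶜ, g y * eBracket (x - y) ^ (-σ) ∂μ := by
  have hmeas : MeasurableSet (Metric.closedBall (0 : E) δ) := measurableSet_closedBall
  set B := Metric.closedBall (0 : E) δ with hB
  set w : E → ℝ≥0∞ := fun x => eBracket x ^ (-σ) with hw
  set N : E → ℝ≥0∞ := fun x => ∫⁻ y in B, g y * w (x - y) ∂μ with hN
  set O : E → ℝ≥0∞ := fun x => ∫⁻ y in Bᶜ, g y * w (x - y) ∂μ with hO
  set J := ∫⁻ y, g y * w (0 - y) ∂μ with hJ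
  have hNO : ∀ x, ∫⁻ y, g y * w (x - y) ∂μ = N x + O x := fun x =>
    (lintegral_add_compl _ hmeas).symm
  have hb2 : ∀ y ∈ B, eBracket y ≤ 2 := by
    intro y hy
    rw [hB, mem_closedBall_zero_iff] at hy
    have : ‖y‖ₑ ≤ 1 := by
      rw [← ofReal_norm]
      exact ENNReal.ofReal_le_one.2 (hy.trans hδ1)
    calc eBracket y ≤ 1 + 1 := by unfold eBracket; gcongr
      _ = 2 := one_add_one_eq_two
  have hcancel : ∀ y : E, eBracket y ^ σ * w y = 1 := fun y => by
    rw [hw, ← ENNReal.rpow_add _ _ (eBracket_ne_zero _) (eBracket_ne_top _)]; simp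
  have hgJ : ∀ y, g y ≤ C * eBracket y ^ σ * J := fun y => by simpa [hJ, hw] using hg 0 y
  have hN0 : N 0 ≤ 2⁻¹ * J := by
    calc N 0 ≤ ∫⁻ y in B, C * J ∂μ := by
          refine lintegral_mono fun y => ?_
          calc g y * w (0 - y) ≤ C * eBracket y ^ σ * J * w y := by
                gcongr
                · exact hgJ y
                · simp [hw]
            _ = C * J * (eBracket y ^ σ * w y) := by ring
            _ = C * J := by rw [hcancel, mul_one]
      _ = C * μ B * J := by rw [setLIntegral_const]; ring
      _ ≤ 2⁻¹ * J := by gcongr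
  have hN0' : N 0 ≠ ∞ := by
    refine ne_top_of_le_ne_top (ENNReal.mul_ne_top hM hμ) ?_
    rw [← setLIntegral_const]
    refine setLIntegral_mono' hmeas fun y hy => ?_
    exact mul_le_of_le_of_le_one (hgM y hy) (eBracket_rpow_neg_le_one _ hσ)
  have hJO : J ≤ 2 * O 0 := by
    have h1 : J = N 0 + O 0 := hNO 0
    rcases eq_or_ne (O 0) ∞ with h | h
    · simp [h]
    have hJtop : J ≠ ∞ := by rw [h1]; exact ENNReal.add_ne_top.2 ⟨hN0', h⟩
    have h2 : 2⁻¹ * J + 2⁻¹ * J ≤ 2⁻¹ * J + O 0 := by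
      rw [← add_mul, ENNReal.inv_two_add_inv_two, one_mul]
      nth_rewrite 1 [h1]
      gcongr
    rw [ENNReal.add_le_add_iff_left (ENNReal.mul_ne_top (by simp) hJtop)] at h2
    calc J = 2 * (2⁻¹ * J) := by
          rw [← mul_assoc, ENNReal.mul_inv_cancel (by simp) (by simp), one_mul]
      _ ≤ 2 * O 0 := by gcongr
  have hO0 : O 0 * w x ≤ O x := by
    rw [hO, ← lintegral_mul_const' _ _ (eBracket_rpow_ne_top _ _)]
    refine lintegral_mono fun y => ?_
    rw [mul_assoc]
    gcongr
    have := eBracket_rpow_neg_mul_le (-y) x hσ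
    simpa [hw, ← sub_eq_neg_add] using this
  have hNx : N x ≤ 2 ^ σ * 2 ^ σ * O x := by
    calc N x ≤ ∫⁻ y in B, C * J * w x * (2 ^ σ * 2 ^ σ) ∂μ := by
          refine setLIntegral_mono' hmeas fun y hy => ?_
          have h3 : w (x - y) ≤ w x * eBracket y ^ σ := by
            have := eBracket_rpow_neg_mul_le (x - y) y hσ
            rw [sub_add_cancel] at this
            calc w (x - y) = w (x - y) * w y * eBracket y ^ σ := by
                  rw [mul_assoc, mul_comm (w y), hcancel, mul_one]
              _ ≤ _ := by gcongr
          calc g y * w (x - y) ≤ C * eBracket y ^ σ * J * (w x * eBracket y ^ σ) := by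
                gcongr
                exact hgJ y
            _ = C * J * w x * (eBracket y ^ σ * eBracket y ^ σ) := by ring
            _ ≤ _ := by
              gcongr
              · exact hb2 y hy
              · exact hb2 y hy
      _ = C * μ B * J * w x * (2 ^ σ * 2 ^ σ) := by rw [setLIntegral_const]; ring
      _ ≤ 2⁻¹ * (2 * O 0) * w x * (2 ^ σ * 2 ^ σ) := by gcongr
      _ = 2 ^ σ * 2 ^ σ * (O 0 * w x) := by
          rw [← mul_assoc 2⁻¹, ENNReal.inv_mul_cancel (by simp) (by simp)]; ring
      _ ≤ _ := by gcongr
  calc g x ≤ C * (N x + O x) := by simpa [← hNO] using hg x x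
    _ ≤ C * (2 ^ σ * 2 ^ σ * O x + O x) := by gcongr
    _ = _ := by ring

end Peetre

section Haar
variable {E : Type*} [NormedAddCommGroup E] [NormedSpace ℝ E] [FiniteDimensional ℝ E]
  [MeasurableSpace E] [BorelSpace E] {μ : Measure E} [μ.IsAddHaarMeasure]

theorem lintegral_eBracket_rpow_neg_ne_top {σ : ℝ} (hσ : Module.finrank ℝ E < σ) :
    ∫⁻ x, eBracket x ^ (-σ) ∂μ ≠ ∞ := by
  refine ne_of_eq_of_ne (lintegral_congr fun x => ?_) (finite_integral_one_add_norm hσ).ne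
  rw [← ENNReal.ofReal_rpow_of_pos (by positivity), ENNReal.ofReal_add (by simp) (by simp)]
  simp [eBracket]

theorem lintegral_comp_smul (f : E → ℝ≥0∞) {c : ℝ} (hc : 0 < c) :
    ∫⁻ x, f (c • x) ∂μ = (ENNReal.ofReal c ^ Module.finrank ℝ E)⁻¹ * ∫⁻ x, f x ∂μ := by
  have h := lintegral_map_equiv (μ := μ) f (Homeomorph.smulOfNeZero c hc.ne').toMeasurableEquiv
  have e : ⇑(Homeomorph.smulOfNeZero c hc.ne' : E ≃ₜ E).toMeasurableEquiv = (c • ·) := rfl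
  rw [e, Measure.map_addHaar_smul μ hc.ne', lintegral_smul_measure] at h
  rw [← h, abs_of_pos (by positivity), ENNReal.ofReal_inv_of_pos (by positivity),
    ENNReal.ofReal_pow hc.le, smul_eq_mul]

end Haar

section Core
variable {E : Type*} [NormedAddCommGroup E] [InnerProductSpace ℝ E] [FiniteDimensional ℝ E]
  [MeasurableSpace E] [BorelSpace E]

theorem SchwartzMap.exists_enorm_le_eBracket_rpow {E : Type*} [NormedAddCommGroup E]
    [NormedSpace ℝ E] (φ : 𝓢(E, ℂ)) (t : ℝ) :
    ∃ D : ℝ≥0∞, D ≠ ∞ ∧ ∀ z, ‖φ z‖ₑ ≤ D * eBracket z ^ (-t) := by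
  obtain ⟨n, hn⟩ := exists_nat_ge t
  obtain ⟨C, hC⟩ := φ.exists_pow_mul_norm_le n
  refine ⟨ENNReal.ofReal C, ENNReal.ofReal_ne_top, fun z => ?_⟩
  have h1 : eBracket z ^ n * ‖φ z‖ₑ ≤ ENNReal.ofReal C := by
    refine le_of_eq_of_le ?_ (ENNReal.ofReal_le_ofReal (hC z))
    rw [ENNReal.ofReal_mul (by positivity), ENNReal.ofReal_pow (by positivity),
      ENNReal.ofReal_add zero_le_one (norm_nonneg z)]
    simp [eBracket]
  calc ‖φ z‖ₑ = eBracket z ^ (-t) * (eBracket z ^ t * ‖φ z‖ₑ) := by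
        rw [← mul_assoc, ← ENNReal.rpow_add _ _ (eBracket_ne_zero _) (eBracket_ne_top _)]; simp
    _ ≤ eBracket z ^ (-t) * (eBracket z ^ n * ‖φ z‖ₑ) := by
        gcongr
        rw [← ENNReal.rpow_natCast]
        exact ENNReal.rpow_le_rpow_of_exponent_le (one_le_eBracket z) hn
    _ ≤ eBracket z ^ (-t) * ENNReal.ofReal C := by gcongr
    _ = _ := mul_comm _ _

theorem exists_mul_measure_closedBall_le [Nontrivial E] {C : ℝ≥0∞} (hC : C ≠ ∞) :
    ∃ δ : ℝ, 0 < δ ∧ δ ≤ 1 ∧ C * volume (Metric.closedBall (0 : E) δ) ≤ 2⁻¹ := by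
  set V := volume (Metric.ball (0 : E) 1) with hV
  have hCV : C * V ≠ ∞ := ENNReal.mul_ne_top hC measure_ball_lt_top.ne
  set a := (C * V).toReal with ha
  have ha0 : 0 ≤ a := ENNReal.toReal_nonneg
  have hδ : 0 < (2 * (a + 1))⁻¹ := by positivity
  have hδ1 : (2 * (a + 1))⁻¹ ≤ 1 := inv_le_one_of_one_le₀ (by linarith)
  refine ⟨(2 * (a + 1))⁻¹, hδ, hδ1, ?_⟩
  rw [Measure.addHaar_closedBall _ _ hδ.le, mul_left_comm, ← ENNReal.ofReal_toReal hCV, ← ha,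
    ← ENNReal.ofReal_mul (by positivity)]
  calc ENNReal.ofReal ((2 * (a + 1))⁻¹ ^ Module.finrank ℝ E * a)
      ≤ ENNReal.ofReal 2⁻¹ := by
        refine ENNReal.ofReal_le_ofReal ?_
        calc (2 * (a + 1))⁻¹ ^ Module.finrank ℝ E * a ≤ (2 * (a + 1))⁻¹ * a := by
              gcongr
              exact pow_le_of_le_one hδ.le hδ1 Module.finrank_pos.ne'
          _ ≤ 2⁻¹ := by
              rw [inv_mul_le_iff₀ (by positivity)]; linarith
    _ = 2⁻¹ := by rw [ENNReal.ofReal_inv_of_pos two_pos]; simp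

/-- Pointwise domination of `‖f‖ ^ p`, for `f` band-limited to `‖ξ‖ ≤ 2 * c`, by averages at
scale `c⁻¹` avoiding a ball around the origin of radius proportional to `c⁻¹`. -/
theorem exists_enorm_rpow_le_setLIntegral [Nontrivial E] {p : ℝ} (hp : 0 < p) :
    ∃ δ : ℝ, 0 < δ ∧ ∃ C : ℝ≥0∞, C ≠ ∞ ∧ ∀ c : ℝ, 0 < c → ∀ f : E → ℂ,
      Function.HasTemperateGrowth f →
      (∀ ψ : 𝓢(E, ℂ), (∀ ξ : E, ‖ξ‖ ≤ c * 2 → ψ ξ = 0) →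
        ∫ x : E, f x * 𝓕 (ψ : E → ℂ) x = 0) →
      ∀ x, ‖f x‖ₑ ^ p ≤ C * ENNReal.ofReal c ^ Module.finrank ℝ E *
        ∫⁻ y in {y | δ < c * ‖y‖},
          ‖f y‖ₑ ^ p * eBracket (c • (x - y)) ^ (-(Module.finrank ℝ E + 1 : ℝ)) := by
  set n := Module.finrank ℝ E with hn
  set σ : ℝ := n + 1 with hσdef
  have hσ : 0 ≤ σ := by positivity
  set r := min p 1 with hr
  have hr0 : 0 < r := lt_min hp one_pos
  have hr1 : r ≤ 1 := min_le_right _ _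
  have hrp : 1 ≤ p / r := (one_le_div hr0).2 (min_le_left _ _)
  set s := σ / r with hs
  have hs0 : 0 ≤ s := by positivity
  have hsr : s * r = σ := div_mul_cancel₀ _ hr0.ne'
  obtain ⟨θ, hθ⟩ := exists_schwartzMap_eq_one_on_ball (E := E) 2 two_pos
  set Φ : 𝓢(E, ℂ) := 𝓕⁻ θ with hΦ
  have hΦc : 𝓕⁻ (θ : E → ℂ) = Φ := (fourierInv_coe θ).symm
  obtain ⟨D, hD, hDΦ⟩ := Φ.exists_enorm_le_eBracket_rpow s
  set C : ℝ≥0∞ := D + 1 with hCdef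
  have hC0 : C ≠ 0 := by simp [hCdef]
  have hC : C ≠ ∞ := by simp [hCdef, hD]
  obtain ⟨δ, hδ, hδ1, hCδ⟩ := exists_mul_measure_closedBall_le (E := E) hC
  set W := ∫⁻ y : E, eBracket y ^ (-σ) with hW
  have hWtop : W ≠ ∞ := lintegral_eBracket_rpow_neg_ne_top (by simp [hσdef, hn])
  set A := C * (1 + 2 ^ σ * 2 ^ σ) with hA
  have h2σ : (2 : ℝ≥0∞) ^ σ ≠ ∞ := ENNReal.rpow_ne_top_of_nonneg hσ (by simp)
  have hAtop : A ≠ ∞ := ENNReal.mul_ne_top hC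
    (ENNReal.add_ne_top.2 ⟨by simp, ENNReal.mul_ne_top h2σ h2σ⟩)
  have hrp0 : 0 ≤ p / r := zero_le_one.trans hrp
  refine ⟨δ, hδ, A ^ (p / r) * W ^ (p / r - 1), ENNReal.mul_ne_top
    (ENNReal.rpow_ne_top_of_nonneg hrp0 hAtop)
    (ENNReal.rpow_ne_top_of_nonneg (sub_nonneg.2 hrp) hWtop), fun c hc f hf hsupp x => ?_⟩
  have hfc : Continuous f := hf.1.continuous
  obtain ⟨m, K, hK⟩ := hf.2 0
  simp only [norm_iteratedFDeriv_zero] at hK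
  have hrep := comp_smul_eq_integral_of_fourier_support hfc hK hc hsupp θ hθ
  rw [hΦc] at hrep
  set u : E → ℝ≥0∞ := fun y => ‖f (c⁻¹ • y)‖ₑ with hu
  have huc : Continuous u := by fun_prop
  have hucv : ∀ x, u x ≤ ∫⁻ y, u y * ‖Φ (x - y)‖ₑ := by
    intro x
    simp only [hu]
    nth_rewrite 1 [hrep x]
    refine (enorm_integral_le_lintegral_enorm _).trans_eq ?_
    simp [enorm_mul]
  have hK0 : 0 ≤ K := by simpa using (norm_nonneg _).trans (hK 0)
  have hgrowth : ∀ y, u y ≤ ENNReal.ofReal (K * (1 + c⁻¹) ^ m) * eBracket y ^ (m : ℝ) := by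
    intro y
    have h1 : ‖f (c⁻¹ • y)‖ ≤ K * (1 + c⁻¹) ^ m * (1 + ‖y‖) ^ m := by
      refine (hK _).trans ?_
      rw [mul_assoc, ← mul_pow, norm_smul, norm_inv, Real.norm_of_nonneg hc.le]
      gcongr
      nlinarith [norm_nonneg y, inv_pos.2 hc]
    simp only [hu]
    rw [← ofReal_norm]
    refine (ENNReal.ofReal_le_ofReal h1).trans_eq ?_
    rw [ENNReal.ofReal_mul (by positivity), ENNReal.ofReal_pow (by positivity),
      ENNReal.ofReal_add zero_le_one (norm_nonneg y), ENNReal.rpow_natCast]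
    simp [eBracket]
  have hpeetre := rpow_le_mul_lintegral_of_polynomial_growth hr0 hr1 hs0 hucv hC0 hC
    (fun z => (hDΦ z).trans (by gcongr; exact le_self_add))
    Φ.exists_enorm_le_eBracket_rpow (Nat.cast_nonneg m) ENNReal.ofReal_ne_top hgrowth
  rw [hsr] at hpeetre
  obtain ⟨z, -, hz⟩ := (isCompact_closedBall (0 : E) δ).exists_isMaxOn
    (Metric.nonempty_closedBall.2 hδ.le) (huc.continuousOn)
  have havoid := le_mul_setLIntegral_compl_closedBall (g := fun y => u y ^ r) (M := u z ^ r) hσ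
    hpeetre hδ1 hCδ measure_closedBall_lt_top.ne
    (ENNReal.rpow_ne_top_of_nonneg hr0.le (by simp [hu]))
    (fun y hy => ENNReal.rpow_le_rpow (hz hy) hr0.le)
  rw [← hA] at havoid
  have hset : MeasurableSet {y : E | δ < c * ‖y‖} :=
    measurableSet_lt (by fun_prop) (by fun_prop)
  have hcompl : {y : E | δ < c * ‖y‖}.indicator
      (fun y => ‖f y‖ₑ ^ p * eBracket (c • (x - y)) ^ (-σ)) = fun y =>
      (Metric.closedBall (0 : E) δ)ᶜ.indicator
        (fun y => u y ^ p * eBracket (c • x - y) ^ (-σ)) (c • y) := by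
    ext y
    simp only [Set.indicator, Set.mem_ofPred_eq, Set.mem_compl_iff, mem_closedBall_zero_iff, not_le,
      norm_smul, Real.norm_of_nonneg hc.le, hu, inv_smul_smul₀ hc.ne', smul_sub]
  have hcn : ENNReal.ofReal c ^ n ≠ 0 := by simp [hc]
  have hcn' : ENNReal.ofReal c ^ n ≠ ∞ := by simp
  rw [← lintegral_indicator hset, hcompl, lintegral_comp_smul _ hc, mul_assoc, ← hn,
    ← mul_assoc (ENNReal.ofReal c ^ n), ENNReal.mul_inv_cancel hcn hcn', one_mul,
    lintegral_indicator measurableSet_closedBall.compl]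
  have e1 : ‖f x‖ₑ ^ p = (u (c • x) ^ r) ^ (p / r) := by
    rw [← ENNReal.rpow_mul, mul_div_cancel₀ _ hr0.ne']
    simp [hu, inv_smul_smul₀ hc.ne']
  rw [e1]
  refine (ENNReal.rpow_le_rpow (havoid (c • x)) hrp0).trans ?_
  rw [ENNReal.mul_rpow_of_nonneg _ _ hrp0, mul_assoc]
  gcongr
  refine (lintegral_mul_rpow_le (by fun_prop) (by fun_prop) hrp).trans ?_
  gcongr ?_ ^ _ * ?_
  · refine (setLIntegral_le_lintegral _ _).trans_eq ?_
    exact lintegral_sub_left_eq_self (fun y => eBracket y ^ (-σ)) (c • x)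
  · refine lintegral_mono fun y => ?_
    rw [← ENNReal.rpow_mul, mul_div_cancel₀ _ hr0.ne']

end Core

section Pieces
variable {α ι : Type*} [MeasurableSpace α] {μ : Measure α}

theorem tsum_setLIntegral_le_mul_iSup {h : α → ℝ≥0∞} {k : α → ℝ≥0∞} {T : ι → Set α}
    {B : ℝ≥0∞} (hT : ∀ i, MeasurableSet (T i)) (hh : Measurable h)
    (hB : ∑' i, ⨆ y ∈ T i, k y ≤ B) :
    ∑' i, ∫⁻ y in T i, h y * k y ∂μ ≤ B * ⨆ i, ∫⁻ y in T i, h y ∂μ := by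
  calc ∑' i, ∫⁻ y in T i, h y * k y ∂μ
      ≤ ∑' i, (⨆ y ∈ T i, k y) * ⨆ i, ∫⁻ y in T i, h y ∂μ := by
        refine ENNReal.tsum_le_tsum fun i => ?_
        calc ∫⁻ y in T i, h y * k y ∂μ ≤ ∫⁻ y in T i, (⨆ y ∈ T i, k y) * h y ∂μ := by
              refine setLIntegral_mono' (hT i) fun y hy => ?_
              rw [mul_comm]
              gcongr
              exact le_iSup₂ (f := fun y (_ : y ∈ T i) => k y) y hy
          _ = (⨆ y ∈ T i, k y) * ∫⁻ y in T i, h y ∂μ := lintegral_const_mul _ hh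
          _ ≤ _ := by gcongr; exact le_iSup (fun i => ∫⁻ y in T i, h y ∂μ) i
    _ ≤ _ := by rw [ENNReal.tsum_mul_right]; gcongr

/-- A Schur-type estimate in which each piece of the domain contributes separately. -/
theorem lintegral_rpow_le_tsum_setLIntegral_rpow [Countable ι] [SFinite μ] {h : α → ℝ≥0∞}
    {k : α → α → ℝ≥0∞} {T : ι → Set α} {M B W : ℝ≥0∞} {t : ℝ} (ht : 1 ≤ t)
    (hT : ∀ i, MeasurableSet (T i)) (hh : Measurable h) (hk : Measurable (Function.uncurry k))
    (hle : ∀ x, h x ≤ M * ∑' i, ∫⁻ y in T i, h y * k x y ∂μ)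
    (hB : ∀ x, ∑' i, ⨆ y ∈ T i, k x y ≤ B) (hW : ∀ y, ∫⁻ x, k x y ∂μ ≤ W)
    (hA : ∀ i, ∫⁻ y in T i, h y ∂μ ≠ ∞) :
    ∫⁻ x, h x ^ t ∂μ ≤
      M ^ t * B ^ (t - 1) * W * ∑' i, (∫⁻ y in T i, h y ∂μ) ^ t := by
  have ht0 : 0 ≤ t := zero_le_one.trans ht
  set A : ι → ℝ≥0∞ := fun i => ∫⁻ y in T i, h y ∂μ with hAdef
  set u : ι → α → ℝ≥0∞ := fun i x => ∫⁻ y in T i, h y * k x y ∂μ with hu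
  have hmeas : Measurable fun p : α × α => h p.2 * k p.1 p.2 :=
    (hh.comp measurable_snd).mul hk
  have hum : ∀ i, Measurable (u i) := fun i => hmeas.lintegral_prod_right'
  have huA : ∀ i x, u i x ≤ (⨆ y ∈ T i, k x y) * A i := by
    intro i x
    rw [hAdef, ← lintegral_const_mul _ hh]
    refine setLIntegral_mono' (hT i) fun y hy => ?_
    rw [mul_comm]
    gcongr
    exact le_iSup₂ (f := fun y (_ : y ∈ T i) => k x y) y hy
  set κ : ι → α → ℝ≥0∞ := fun i x => (A i)⁻¹ * u i x with hκ
  have hκm : ∀ i, Measurable (κ i) := fun i => (hum i).const_mul _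
  have hAκ : ∀ i x, A i * κ i x = u i x := by
    intro i x
    rcases eq_or_ne (A i) 0 with h0 | h0
    · have : u i x = 0 := le_antisymm ((huA i x).trans (by simp [h0])) zero_le
      simp [h0, this]
    · rw [hκ, ← mul_assoc, ENNReal.mul_inv_cancel h0 (hA i), one_mul]
  have hκB : ∀ x, ∑' i, κ i x ≤ B := by
    intro x
    refine (ENNReal.tsum_le_tsum fun i => ?_).trans (hB x)
    calc (A i)⁻¹ * u i x ≤ (A i)⁻¹ * ((⨆ y ∈ T i, k x y) * A i) := by gcongr; exact huA i x
      _ = ((A i)⁻¹ * A i) * ⨆ y ∈ T i, k x y := by ring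
      _ ≤ 1 * ⨆ y ∈ T i, k x y := by gcongr; exact ENNReal.inv_mul_le_one _
      _ = _ := one_mul _
  have hκW : ∀ i, ∫⁻ x, κ i x ∂μ ≤ W := by
    intro i
    rw [hκ, lintegral_const_mul _ (hum i), hu,
      lintegral_lintegral_swap hmeas.aemeasurable]
    calc (A i)⁻¹ * ∫⁻ y in T i, ∫⁻ x, h y * k x y ∂μ ∂μ
        ≤ (A i)⁻¹ * ∫⁻ y in T i, h y * W ∂μ := by
          gcongr with y
          rw [lintegral_const_mul _ (hk.of_uncurry_right (y := y))]
          gcongr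
          exact hW y
      _ = ((A i)⁻¹ * A i) * W := by rw [lintegral_mul_const _ hh, mul_assoc]
      _ ≤ 1 * W := by gcongr; exact ENNReal.inv_mul_le_one _
      _ = W := one_mul W
  calc ∫⁻ x, h x ^ t ∂μ ≤ ∫⁻ x, M ^ t * B ^ (t - 1) * ∑' i, A i ^ t * κ i x ∂μ := by
        refine lintegral_mono fun x => ?_
        calc h x ^ t ≤ (M * ∑' i, A i * κ i x) ^ t := by
              gcongr
              simpa only [hAκ] using hle x
          _ = M ^ t * (∑' i, A i * κ i x) ^ t := ENNReal.mul_rpow_of_nonneg _ _ ht0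
          _ ≤ M ^ t * ((∑' i, κ i x) ^ (t - 1) * ∑' i, A i ^ t * κ i x) := by
              gcongr
              exact ENNReal.tsum_mul_rpow_le _ _ ht
          _ ≤ M ^ t * (B ^ (t - 1) * ∑' i, A i ^ t * κ i x) := by
              gcongr
              exact hκB x
          _ = _ := (mul_assoc _ _ _).symm
    _ = M ^ t * B ^ (t - 1) * ∑' i, A i ^ t * ∫⁻ x, κ i x ∂μ := by
        rw [lintegral_const_mul _ (Measurable.tsum fun i => (hκm i).const_mul _),
          lintegral_tsum fun i => ((hκm i).const_mul _).aemeasurable]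
        simp_rw [lintegral_const_mul _ (hκm _)]
    _ ≤ M ^ t * B ^ (t - 1) * ∑' i, A i ^ t * W := by
        gcongr
        exact hκW _
    _ = _ := by rw [ENNReal.tsum_mul_right]; ring

end Pieces

section Dyadic

theorem tsum_ite_lt_two_pow_le_two {a s : ℝ} (ha : 0 < a) :
    ∑' l : ℕ, (if s < a * 2 ^ l then ENNReal.ofReal (s / (a * 2 ^ l)) else 0) ≤ 2 := by
  have hex : ∃ l : ℕ, s < a * 2 ^ l := by
    obtain ⟨l, hl⟩ := pow_unbounded_of_one_lt (s / a) one_lt_two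
    exact ⟨l, by rwa [div_lt_iff₀' ha] at hl⟩
  classical
  set n := Nat.find hex with hn
  rw [← Summable.sum_add_tsum_nat_add' (k := n) ENNReal.summable, Finset.sum_eq_zero, zero_add,
    ← ENNReal.tsum_geometric_two]
  · refine ENNReal.tsum_le_tsum fun j => ?_
    split_ifs
    · have h2 : (2⁻¹ : ℝ≥0∞) ^ j = ENNReal.ofReal (2⁻¹ ^ j) := by
        rw [ENNReal.ofReal_pow (by norm_num), ENNReal.ofReal_inv_of_pos two_pos]; simp
      rw [h2]
      refine ENNReal.ofReal_le_ofReal ?_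
      rw [div_le_iff₀ (by positivity), pow_add, inv_pow]
      have h3 := (Nat.find_spec hex).le
      rw [← hn] at h3
      calc s ≤ a * 2 ^ n := h3
        _ = (2 ^ j)⁻¹ * (a * (2 ^ j * 2 ^ n)) := by field_simp
    · exact zero_le
  · intro l hl
    exact if_neg (Nat.find_min hex (Finset.mem_range.1 hl))

end Dyadic

section Shells

theorem measurableSet_Bshell (d l : ℕ) : MeasurableSet (Bshell d l) := by
  unfold Bshell
  split_ifs
  · exact measurableSet_le measurable_norm measurable_const
  · exact (measurableSet_lt measurable_const measurable_norm).inter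
      (measurableSet_le measurable_norm measurable_const)

theorem norm_le_of_mem_Bshell {d l : ℕ} {x : Ed d} (hx : x ∈ Bshell d l) :
    ‖x‖ ≤ 2 ^ (l + 1) := by
  unfold Bshell at hx
  split_ifs at hx with h
  · simpa [h] using hx
  · exact hx.2

theorem lt_norm_of_mem_Bshell {d l : ℕ} (hl : l ≠ 0) {x : Ed d} (hx : x ∈ Bshell d l) :
    2 ^ l < ‖x‖ := by
  unfold Bshell at hx
  rw [if_neg hl] at hx
  exact hx.1

theorem iUnion_Bshell (d : ℕ) : ⋃ l, Bshell d l = Set.univ := by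
  classical
  refine Set.eq_univ_of_forall fun x => Set.mem_iUnion.2 ?_
  have hex : ∃ l : ℕ, ‖x‖ ≤ 2 ^ (l + 1) := by
    obtain ⟨l, hl⟩ := pow_unbounded_of_one_lt ‖x‖ one_lt_two
    exact ⟨l, hl.le.trans (pow_le_pow_right₀ one_le_two l.le_succ)⟩
  refine ⟨Nat.find hex, ?_⟩
  have h1 := Nat.find_spec hex
  unfold Bshell
  split_ifs with h
  · simpa [h] using h1
  · obtain ⟨n, hn⟩ := Nat.exists_eq_succ_of_ne_zero h
    refine ⟨?_, h1⟩
    have := Nat.find_min hex (m := n) (by omega)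
    rw [hn]
    exact not_le.1 this

theorem eBracket_rpow_neg_le_ofReal_inv {E : Type*} [NormedAddCommGroup E] {z : E} {σ ρ : ℝ}
    (hσ : 1 ≤ σ) (hρ : 0 < ρ) (hz : ρ ≤ ‖z‖) :
    eBracket z ^ (-σ) ≤ ENNReal.ofReal ρ⁻¹ := by
  calc eBracket z ^ (-σ) ≤ eBracket z ^ (-1 : ℝ) :=
        ENNReal.rpow_le_rpow_of_exponent_le (one_le_eBracket z) (by linarith)
    _ = (eBracket z)⁻¹ := ENNReal.rpow_neg_one _
    _ ≤ (ENNReal.ofReal ρ)⁻¹ := by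
        gcongr
        calc ENNReal.ofReal ρ ≤ ‖z‖ₑ := by
              rw [← ofReal_norm]; exact ENNReal.ofReal_le_ofReal hz
          _ ≤ eBracket z := le_add_self
    _ = _ := (ENNReal.ofReal_inv_of_pos hρ).symm

/-- The suprema of a decaying kernel over the dilated shells away from the origin are summable,
uniformly in the centre and in the dilation. -/
theorem tsum_iSup_Bshell_le {d : ℕ} {δ c σ : ℝ} (hδ : 0 < δ) (hc : 0 < c) (hσ : 1 ≤ σ)
    (x : Ed d) :
    ∑' l, ⨆ y ∈ Bshell d l ∩ {y | δ < c * ‖y‖}, eBracket (c • (x - y)) ^ (-σ) ≤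
      1 + ENNReal.ofReal (4 / δ) * 2 + 8 * 2 := by
  set a := 2 * c with ha
  have ha0 : 0 < a := by positivity
  set X := c * ‖x‖ with hX
  have hX0 : 0 ≤ X := by positivity
  have key : ∀ l, ⨆ y ∈ Bshell d l ∩ {y | δ < c * ‖y‖}, eBracket (c • (x - y)) ^ (-σ) ≤
      (if l = 0 then 1 else 0) +
      ENNReal.ofReal (4 / δ) *
        (if δ < a * 2 ^ l then ENNReal.ofReal (δ / (a * 2 ^ l)) else 0) +
      8 * (if X / 2 < a * 2 ^ l then ENNReal.ofReal (X / 2 / (a * 2 ^ l)) else 0) := by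
    intro l
    refine iSup₂_le fun y hy => ?_
    have hone := eBracket_rpow_neg_le_one (c • (x - y)) (zero_le_one.trans hσ)
    rcases eq_or_ne l 0 with hl | hl
    · rw [if_pos hl, add_assoc]
      exact hone.trans le_self_add
    rw [if_neg hl, zero_add]
    have h1 : c * ‖y‖ ≤ a * 2 ^ l := by
      have := mul_le_mul_of_nonneg_left (norm_le_of_mem_Bshell hy.1) hc.le
      rw [pow_succ] at this
      linarith
    have h2 : a * 2 ^ l / 2 < c * ‖y‖ := by
      have := mul_lt_mul_of_pos_left (lt_norm_of_mem_Bshell hl hy.1) hc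
      rw [ha]; linarith
    have h3 : δ < a * 2 ^ l := hy.2.trans_le h1
    rw [if_pos h3]
    set ν := a * 2 ^ l with hν
    have hν0 : 0 < ν := by positivity
    by_cases hfar : ν / 4 ≤ ‖c • (x - y)‖
    · refine (eBracket_rpow_neg_le_ofReal_inv hσ (by positivity) hfar).trans ?_
      refine le_trans (le_of_eq ?_) le_self_add
      rw [← ENNReal.ofReal_mul (by positivity)]
      congr 1
      field_simp
    · rw [not_le, norm_smul, Real.norm_of_nonneg hc.le] at hfar
      have h4 : X ≤ c * ‖y‖ + c * ‖x - y‖ := by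
        rw [hX, ← mul_add]
        gcongr
        simpa using norm_add_le y (x - y)
      have h5 : c * ‖y‖ ≤ X + c * ‖x - y‖ := by
        rw [hX, ← mul_add]
        gcongr
        simpa using norm_sub_le x (x - y)
      rw [if_pos (by linarith)]
      refine hone.trans (le_trans ?_ le_add_self)
      have h8 : (8 : ℝ≥0∞) = ENNReal.ofReal 8 := by simp
      rw [h8, ← ENNReal.ofReal_mul (by norm_num), ENNReal.one_le_ofReal, ← mul_div_assoc,
        le_div_iff₀ hν0]
      linarith
  refine (ENNReal.tsum_le_tsum key).trans ?_
  rw [ENNReal.tsum_add, ENNReal.tsum_add, ENNReal.tsum_mul_left, ENNReal.tsum_mul_left,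
    tsum_ite_eq]
  gcongr
  · exact tsum_ite_lt_two_pow_le_two ha0
  · exact tsum_ite_lt_two_pow_le_two ha0

end Shells

section Nikolskii

theorem ofReal_two_zpow_pow (k : ℤ) (d : ℕ) :
    ENNReal.ofReal ((2 : ℝ) ^ k) ^ d = ENNReal.ofReal ((2 : ℝ) ^ ((k : ℝ) * d)) := by
  rw [← ENNReal.ofReal_pow (by positivity), Real.rpow_mul two_pos.le, Real.rpow_intCast,
    Real.rpow_natCast]

theorem ofReal_two_rpow_rpow (a b : ℝ) :
    ENNReal.ofReal ((2 : ℝ) ^ a) ^ b = ENNReal.ofReal ((2 : ℝ) ^ (a * b)) := by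
  rw [ENNReal.ofReal_rpow_of_pos (by positivity), Real.rpow_mul two_pos.le]

theorem eLpNorm_rpow_toReal {α F : Type*} [MeasurableSpace α] [NormedAddCommGroup F]
    {μ : Measure α} {f : α → F} {p : ℝ≥0∞} (hp0 : p ≠ 0) (hp : p ≠ ∞) :
    eLpNorm f p μ ^ p.toReal = ∫⁻ x, ‖f x‖ₑ ^ p.toReal ∂μ := by
  rw [eLpNorm_eq_lintegral_rpow_enorm_toReal hp0 hp, one_div,
    ENNReal.rpow_inv_rpow (ENNReal.toReal_pos hp0 hp).ne']

theorem herzNorm_zero_top (d : ℕ) (p : ℝ≥0∞) (f : Ed d → ℂ) :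
    herzNorm d p 0 ∞ f = ⨆ l : ℕ, eLpNorm f p (volume.restrict (Bshell d l)) := by
  simp [herzNorm]

theorem herzNorm_zero_rpow {d : ℕ} {p q : ℝ≥0∞} (hq0 : q ≠ 0) (hq : q ≠ ∞) (f : Ed d → ℂ) :
    herzNorm d p 0 q f ^ q.toReal =
      ∑' l : ℕ, eLpNorm f p (volume.restrict (Bshell d l)) ^ q.toReal := by
  rw [herzNorm, if_neg hq, one_div, ENNReal.rpow_inv_rpow (ENNReal.toReal_pos hq0 hq).ne']
  simp

/-- Pointwise domination of `‖f‖ ^ p`, for `f` band-limited to `‖ξ‖ ≤ 2 ^ (k + 1)`, by a sum of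
averages over the dyadic shells. -/
theorem exists_enorm_rpow_le_tsum_Bshell {d : ℕ} (hd : 1 ≤ d) {p : ℝ} (hp : 0 < p) :
    ∃ δ : ℝ, 0 < δ ∧ ∃ C : ℝ≥0∞, C ≠ ∞ ∧ ∀ (k : ℤ) (f : Ed d → ℂ),
      Function.HasTemperateGrowth f →
      (∀ ψ : 𝓢(Ed d, ℂ), (∀ ξ : Ed d, ‖ξ‖ ≤ (2 : ℝ) ^ (k + 1) → ψ ξ = 0) →
        ∫ x : Ed d, f x * 𝓕 (ψ : Ed d → ℂ) x = 0) →
      ∀ x, ‖f x‖ₑ ^ p ≤ C * ENNReal.ofReal ((2 : ℝ) ^ ((k : ℝ) * d)) *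
        ∑' l, ∫⁻ y in Bshell d l ∩ {y | δ < (2 : ℝ) ^ k * ‖y‖},
          ‖f y‖ₑ ^ p * eBracket ((2 : ℝ) ^ k • (x - y)) ^ (-(d + 1 : ℝ)) := by
  have hfin : Module.finrank ℝ (Ed d) = d := finrank_euclideanSpace_fin
  have : Nontrivial (Ed d) := Module.nontrivial_of_finrank_pos (R := ℝ) (by omega)
  obtain ⟨δ, hδ, C, hC, h⟩ := exists_enorm_rpow_le_setLIntegral (E := Ed d) hp
  refine ⟨δ, hδ, C, hC, fun k f hf hsupp x => ?_⟩
  have h1 := h ((2 : ℝ) ^ k) (by positivity) f hf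
    (by simpa only [zpow_add_one₀ (two_ne_zero' ℝ)] using hsupp) x
  rw [hfin, ofReal_two_zpow_pow] at h1
  refine h1.trans ?_
  gcongr
  refine le_of_eq_of_le ?_ (lintegral_iUnion_le _ _)
  rw [← Set.iUnion_inter, iUnion_Bshell, Set.univ_inter]

theorem exists_eLpNorm_top_le_herzNorm {d : ℕ} (hd : 1 ≤ d) {p : ℝ≥0∞} (hp0 : p ≠ 0)
    (hp : p ≠ ∞) :
    ∃ C : ℝ≥0∞, C ≠ ∞ ∧ ∀ (k : ℤ) (f : Ed d → ℂ), Function.HasTemperateGrowth f →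
      (∀ ψ : 𝓢(Ed d, ℂ), (∀ ξ : Ed d, ‖ξ‖ ≤ (2 : ℝ) ^ (k + 1) → ψ ξ = 0) →
        ∫ x : Ed d, f x * 𝓕 (ψ : Ed d → ℂ) x = 0) →
      eLpNorm f ∞ volume ≤
        C * ENNReal.ofReal ((2 : ℝ) ^ ((k : ℝ) * d * (1 / p.toReal))) *
          herzNorm d p 0 ∞ f := by
  have hP : 0 < p.toReal := ENNReal.toReal_pos hp0 hp
  obtain ⟨δ, hδ, C, hC, h⟩ := exists_enorm_rpow_le_tsum_Bshell hd hP
  set B : ℝ≥0∞ := 1 + ENNReal.ofReal (4 / δ) * 2 + 8 * 2 with hB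
  have hBtop : B ≠ ∞ := by simp [hB, ENNReal.mul_eq_top]
  refine ⟨(C * B) ^ (1 / p.toReal), ENNReal.rpow_ne_top_of_nonneg (by positivity)
    (ENNReal.mul_ne_top hC hBtop), fun k f hf hsupp => ?_⟩
  have hfm : Measurable fun x => ‖f x‖ₑ ^ p.toReal :=
    (hf.1.continuous.measurable.enorm).pow_const _
  rw [eLpNorm_exponent_top]
  refine eLpNormEssSup_le_of_ae_enorm_bound (.of_forall fun x => ?_)
  set H := herzNorm d p 0 ∞ f with hH
  have h1 : ‖f x‖ₑ ^ p.toReal ≤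
      C * B * ENNReal.ofReal ((2 : ℝ) ^ ((k : ℝ) * d)) * H ^ p.toReal := by
    refine (h k f hf hsupp x).trans ?_
    rw [mul_right_comm C B, mul_assoc _ B]
    gcongr
    refine (tsum_setLIntegral_le_mul_iSup
      (fun l => (measurableSet_Bshell d l).inter
        (measurableSet_lt (f := fun _ => δ) (g := fun y : Ed d => (2 : ℝ) ^ k * ‖y‖)
          (by fun_prop) (by fun_prop)))
      hfm (tsum_iSup_Bshell_le hδ (by positivity) (by simp) x)).trans ?_
    gcongr
    refine iSup_le fun l => (lintegral_mono_set Set.inter_subset_left).trans ?_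
    rw [← eLpNorm_rpow_toReal hp0 hp, hH, herzNorm_zero_top]
    gcongr
    exact le_iSup (fun l => eLpNorm f p (volume.restrict (Bshell d l))) l
  have h2 := ENNReal.rpow_le_rpow h1 (one_div_nonneg.2 hP.le)
  rw [one_div, ENNReal.rpow_rpow_inv hP.ne', ENNReal.mul_rpow_of_nonneg _ _ (by positivity),
    ENNReal.mul_rpow_of_nonneg _ _ (by positivity), ofReal_two_rpow_rpow,
    ENNReal.rpow_rpow_inv hP.ne'] at h2
  simpa only [one_div] using h2

theorem exists_eLpNorm_le_herzNorm {d : ℕ} (hd : 1 ≤ d) {p q : ℝ≥0∞} (hp0 : p ≠ 0)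
    (hpq : p ≤ q) (hq : q ≠ ∞) :
    ∃ C : ℝ≥0∞, C ≠ ∞ ∧ ∀ (k : ℤ) (f : Ed d → ℂ), Function.HasTemperateGrowth f →
      (∀ ψ : 𝓢(Ed d, ℂ), (∀ ξ : Ed d, ‖ξ‖ ≤ (2 : ℝ) ^ (k + 1) → ψ ξ = 0) →
        ∫ x : Ed d, f x * 𝓕 (ψ : Ed d → ℂ) x = 0) →
      herzNorm d p 0 q f ≠ ∞ →
      eLpNorm f q volume ≤
        C * ENNReal.ofReal ((2 : ℝ) ^ ((k : ℝ) * d * (1 / p.toReal - 1 / q.toReal))) *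
          herzNorm d p 0 q f := by
  have hp : p ≠ ∞ := ne_top_of_le_ne_top hq hpq
  have hq0 : q ≠ 0 := (hp0.bot_lt.trans_le hpq).ne'
  have hP : 0 < p.toReal := ENNReal.toReal_pos hp0 hp
  have hQ : 0 < q.toReal := ENNReal.toReal_pos hq0 hq
  obtain ⟨δ, hδ, C, hC, h⟩ := exists_enorm_rpow_le_tsum_Bshell hd hP
  set B : ℝ≥0∞ := 1 + ENNReal.ofReal (4 / δ) * 2 + 8 * 2 with hB
  have hBtop : B ≠ ∞ := by simp [hB, ENNReal.mul_eq_top]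
  set W := ∫⁻ x : Ed d, eBracket x ^ (-(d + 1 : ℝ)) with hW
  have hWtop : W ≠ ∞ := lintegral_eBracket_rpow_neg_ne_top (by simp)
  set t := q.toReal / p.toReal with ht
  have ht1 : 1 ≤ t := (one_le_div hP).2 (ENNReal.toReal_mono hq hpq)
  have ht0 : 0 ≤ t := zero_le_one.trans ht1
  have hPt : p.toReal * t = q.toReal := mul_div_cancel₀ _ hP.ne'
  refine ⟨(C ^ t * B ^ (t - 1) * W) ^ (1 / q.toReal),
    ENNReal.rpow_ne_top_of_nonneg (by positivity) (ENNReal.mul_ne_top (ENNReal.mul_ne_top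
      (ENNReal.rpow_ne_top_of_nonneg ht0 hC)
      (ENNReal.rpow_ne_top_of_nonneg (sub_nonneg.2 ht1) hBtop)) hWtop),
    fun k f hf hsupp hH => ?_⟩
  have hfm : Measurable fun x => ‖f x‖ₑ ^ p.toReal :=
    (hf.1.continuous.measurable.enorm).pow_const _
  have hc : (0 : ℝ) < 2 ^ k := by positivity
  set L := ENNReal.ofReal ((2 : ℝ) ^ ((k : ℝ) * d)) with hL
  have hL0 : L ≠ 0 := by simp only [hL, ne_eq, ENNReal.ofReal_eq_zero, not_le]; positivity
  have hLtop : L ≠ ∞ := ENNReal.ofReal_ne_top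
  have hkW : ∀ y : Ed d, ∫⁻ x, eBracket ((2 : ℝ) ^ k • (x - y)) ^ (-(d + 1 : ℝ)) ≤ L⁻¹ * W := by
    intro y
    rw [lintegral_sub_right_eq_self
      (fun x : Ed d => eBracket ((2 : ℝ) ^ k • x) ^ (-(d + 1 : ℝ))) y,
      lintegral_comp_smul (fun x : Ed d => eBracket x ^ (-(d + 1 : ℝ))) hc,
      finrank_euclideanSpace_fin, ofReal_two_zpow_pow]
  have hA : ∀ l, (∫⁻ y in Bshell d l, ‖f y‖ₑ ^ p.toReal) ^ t =
      eLpNorm f p (volume.restrict (Bshell d l)) ^ q.toReal := fun l => by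
    rw [← eLpNorm_rpow_toReal hp0 hp, ← ENNReal.rpow_mul, hPt]
  have hsum : ∑' l, (∫⁻ y in Bshell d l, ‖f y‖ₑ ^ p.toReal) ^ t =
      herzNorm d p 0 q f ^ q.toReal := by
    rw [herzNorm_zero_rpow hq0 hq]
    exact tsum_congr hA
  have hAtop : ∀ l, ∫⁻ y in Bshell d l, ‖f y‖ₑ ^ p.toReal ≠ ∞ := by
    intro l hl
    have h1 := ENNReal.ne_top_of_tsum_ne_top
      (hsum ▸ ENNReal.rpow_ne_top_of_nonneg hQ.le hH) l
    rw [hl, ENNReal.top_rpow_of_pos (by positivity)] at h1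
    exact h1 rfl
  have hkm : Measurable (Function.uncurry fun x y : Ed d =>
      eBracket ((2 : ℝ) ^ k • (x - y)) ^ (-(d + 1 : ℝ))) := by
    unfold Function.uncurry
    fun_prop
  have key := lintegral_rpow_le_tsum_setLIntegral_rpow ht1
    (fun l => (measurableSet_Bshell d l).inter
      (measurableSet_lt (f := fun _ => δ) (g := fun y : Ed d => (2 : ℝ) ^ k * ‖y‖)
        (by fun_prop) (by fun_prop)))
    hfm hkm (h k f hf hsupp) (tsum_iSup_Bshell_le hδ hc (by simp)) hkW
    (fun l => ne_top_of_le_ne_top (hAtop l) (lintegral_mono_set Set.inter_subset_left))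
  have key' : eLpNorm f q volume ^ q.toReal ≤
      C ^ t * B ^ (t - 1) * W * L ^ (t - 1) * herzNorm d p 0 q f ^ q.toReal := by
    rw [eLpNorm_rpow_toReal hq0 hq, ← hsum]
    calc ∫⁻ x, ‖f x‖ₑ ^ q.toReal = ∫⁻ x, (‖f x‖ₑ ^ p.toReal) ^ t := by
          simp_rw [← ENNReal.rpow_mul, hPt]
      _ ≤ _ := key
      _ ≤ (C * L) ^ t * B ^ (t - 1) * (L⁻¹ * W) *
          ∑' l, (∫⁻ y in Bshell d l, ‖f y‖ₑ ^ p.toReal) ^ t := by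
          gcongr
          exact Set.inter_subset_left
      _ = _ := by
          rw [ENNReal.mul_rpow_of_nonneg _ _ ht0, ENNReal.rpow_sub _ _ hL0 hLtop,
            ENNReal.rpow_one, div_eq_mul_inv]
          ring
  have h2 := ENNReal.rpow_le_rpow key' (one_div_nonneg.2 hQ.le)
  have hexp : (t - 1) * (1 / q.toReal) = 1 / p.toReal - 1 / q.toReal := by
    rw [ht]; field_simp
  rwa [one_div, ENNReal.rpow_rpow_inv hQ.ne', ← one_div,
    ENNReal.mul_rpow_of_nonneg _ _ (by positivity),
    ENNReal.mul_rpow_of_nonneg _ _ (by positivity), ← ENNReal.rpow_mul, hexp, hL,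
    ofReal_two_rpow_rpow, one_div q.toReal, ENNReal.rpow_rpow_inv hQ.ne', ← one_div] at h2

end Nikolskii

/-- Lemma 5.1 (improved Nikolskii inequality): for `0 < p < q ≤ ∞` and band-limited
`f ∈ S' ∩ K_p^{0,q}` with `supp 𝓕f ⊆ {|ξ| ≤ 2^{k+1}}`,
`‖f‖_{L^q} ≲ 2^{kd(1/p - 1/q)} ‖f‖_{K_p^{0,q}}`.  (A tempered distribution with Fourier
transform of compact support is automatically a smooth function of temperate growth; the
Fourier support condition is expressed by testing against Schwartz functions vanishing on
the ball.) -/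
theorem nikolskii_herz
    (d : ℕ) (hd : 1 ≤ d) (p q : ℝ≥0∞) (hp : 0 < p) (hpq : p < q) :
    ∃ C : ℝ≥0∞, 0 < C ∧ C < ∞ ∧
      ∀ (k : ℤ) (f : Ed d → ℂ), Function.HasTemperateGrowth f →
        (∀ ψ : 𝓢(Ed d, ℂ), (∀ ξ : Ed d, ‖ξ‖ ≤ (2:ℝ)^(k+1) → ψ ξ = 0) →
          ∫ x : Ed d, f x * 𝓕 (ψ : Ed d → ℂ) x = 0) →
        herzNorm d p 0 q f < ∞ →
        eLpNorm f q volume ≤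
          C * ENNReal.ofReal ((2:ℝ) ^ ((k : ℝ) * d * (1 / p.toReal - 1 / q.toReal))) *
            herzNorm d p 0 q f := by
  rcases eq_or_ne q ∞ with rfl | hq
  · obtain ⟨C, hC, h⟩ := exists_eLpNorm_top_le_herzNorm hd hp.ne' hpq.ne
    refine ⟨C + 1, by simp, by simpa using hC.lt_top, fun k f hf hsupp _ => ?_⟩
    refine (h k f hf hsupp).trans ?_
    simp only [ENNReal.toReal_top, _root_.div_zero, _root_.sub_zero]
    gcongr
    exact le_self_add
  · obtain ⟨C, hC, h⟩ := exists_eLpNorm_le_herzNorm hd hp.ne' hpq.le hq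
    refine ⟨C + 1, by simp, by simpa using hC.lt_top, fun k f hf hsupp hH => ?_⟩
    refine (h k f hf hsupp hH.ne).trans ?_
    gcongr
    exact le_self_add
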